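/- arXiv:2109.05431 — 6 statements merged into one kernel-verified Lean document; each statement's English description precedes it below -/
import Mathlib

section
/- (Proposition 2.1) For K > 0, the spread option price Π_T = e^{-rT}·E[(S₁(T) - S₂(T) - K)⁺] satisfies Π_T = e^{-rT}·F₁·P(g₁F̄₁·e^{σ₁√T·Y} - ᾱF̄₂·e^{σ₂√T·X} - K ≥ 0) - e^{-rT}·F₂·P(ᾱF̄₁·e^{σ₁√T·Y} - g₂F̄₂·e^{σ₂√T·X} - K ≥ 0) - e^{-rT}·K·P(F̄₁·e^{σ₁√T·Y} - F̄₂·e^{σ₂√T·X} - K ≥ 0). -/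
open MeasureTheory ProbabilityTheory Real

/-- One-dimensional Cameron–Martin formula for the standard Gaussian measure. -/
lemma integral_exp_mul_gaussianReal_eq_integral_add (a : ℝ) (f : ℝ → ℝ) :
    ∫ x, Real.exp (a * x - a ^ 2 / 2) * f x ∂gaussianReal 0 1
      = ∫ x, f (x + a) ∂gaussianReal 0 1 := by
  rw [integral_gaussianReal_eq_integral_smul one_ne_zero,
    integral_gaussianReal_eq_integral_smul one_ne_zero,
    ← integral_add_right_eq_self _ a]
  congr 1 with x
  simp only [gaussianPDFReal, smul_eq_mul, ← mul_assoc]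
  congr 1
  rw [mul_assoc, ← Real.exp_add]
  congr 2
  norm_num
  ring

lemma integrable_exp_mul_sub_gaussianReal (a : ℝ) :
    Integrable (fun x => Real.exp (a * x - a ^ 2 / 2)) (gaussianReal 0 1) := by
  simpa only [Real.exp_sub] using (integrable_exp_mul_gaussianReal a).div_const _

/-- Integrability of the two-dimensional Cameron–Martin density. -/
lemma integrable_exp_prod_gaussianReal (a b : ℝ) :
    Integrable (fun p : ℝ × ℝ =>
        Real.exp (a * p.1 - a ^ 2 / 2) * Real.exp (b * p.2 - b ^ 2 / 2))
      ((gaussianReal 0 1).prod (gaussianReal 0 1)) :=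
  (integrable_exp_mul_sub_gaussianReal a).mul_prod (integrable_exp_mul_sub_gaussianReal b)

/-- Two-dimensional Cameron–Martin formula for the standard Gaussian measure. -/
lemma setIntegral_exp_prod_gaussianReal (a b : ℝ) {s : Set (ℝ × ℝ)} (hs : MeasurableSet s) :
    ∫ p in s, Real.exp (a * p.1 - a ^ 2 / 2) * Real.exp (b * p.2 - b ^ 2 / 2)
        ∂((gaussianReal 0 1).prod (gaussianReal 0 1))
      = ((gaussianReal 0 1).prod (gaussianReal 0 1)).real
          {p | (p.1 + a, p.2 + b) ∈ s} := by
  have hs' : MeasurableSet {p : ℝ × ℝ | (p.1 + a, p.2 + b) ∈ s} :=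
    hs.preimage (f := fun p : ℝ × ℝ => (p.1 + a, p.2 + b)) (by fun_prop)
  rw [← integral_indicator hs, ← integral_indicator_one hs',
    integral_prod _ ((integrable_exp_prod_gaussianReal a b).indicator hs),
    integral_prod ({p : ℝ × ℝ | (p.1 + a, p.2 + b) ∈ s}.indicator 1)
      ((integrable_const (1 : ℝ)).indicator hs')]
  have inner (x : ℝ) :
      ∫ y, s.indicator (fun p : ℝ × ℝ =>
          Real.exp (a * p.1 - a ^ 2 / 2) * Real.exp (b * p.2 - b ^ 2 / 2)) (x, y)
          ∂gaussianReal 0 1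
        = Real.exp (a * x - a ^ 2 / 2) *
          ∫ y, s.indicator (1 : ℝ × ℝ → ℝ) (x, y + b) ∂gaussianReal 0 1 := by
    rw [← integral_exp_mul_gaussianReal_eq_integral_add b
      (fun y => s.indicator (1 : ℝ × ℝ → ℝ) (x, y)), ← integral_const_mul]
    congr 1 with y
    by_cases h : (x, y) ∈ s <;> simp [h]
  simp_rw [inner]
  exact integral_exp_mul_gaussianReal_eq_integral_add a
    (fun x => ∫ y, s.indicator (1 : ℝ × ℝ → ℝ) (x, y + b) ∂gaussianReal 0 1)

section IndependentGaussians

variable {Ω : Type*} [MeasurableSpace Ω] {P : Measure Ω} [IsProbabilityMeasure P]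
  {Z₁ Z₂ : Ω → ℝ}

lemma map_prodMk_eq_prod_gaussianReal (hmZ₁ : Measurable Z₁) (hmZ₂ : Measurable Z₂)
    (hZ₁ : Measure.map Z₁ P = gaussianReal 0 1) (hZ₂ : Measure.map Z₂ P = gaussianReal 0 1)
    (hindep : IndepFun Z₁ Z₂ P) :
    P.map (fun ω => (Z₁ ω, Z₂ ω)) = (gaussianReal 0 1).prod (gaussianReal 0 1) := by
  rw [(indepFun_iff_map_prod_eq_prod_map_map hmZ₁.aemeasurable hmZ₂.aemeasurable).1 hindep,
    hZ₁, hZ₂]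

lemma integrable_exp_of_indepFun_gaussianReal (hmZ₁ : Measurable Z₁) (hmZ₂ : Measurable Z₂)
    (hZ₁ : Measure.map Z₁ P = gaussianReal 0 1) (hZ₂ : Measure.map Z₂ P = gaussianReal 0 1)
    (hindep : IndepFun Z₁ Z₂ P) (a b : ℝ) :
    Integrable (fun ω =>
      Real.exp (a * Z₁ ω - a ^ 2 / 2) * Real.exp (b * Z₂ ω - b ^ 2 / 2)) P := by
  have h := integrable_exp_prod_gaussianReal a b
  rw [← map_prodMk_eq_prod_gaussianReal hmZ₁ hmZ₂ hZ₁ hZ₂ hindep] at h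
  exact h.comp_measurable (hmZ₁.prodMk hmZ₂)

lemma setIntegral_exp_of_indepFun_gaussianReal (hmZ₁ : Measurable Z₁) (hmZ₂ : Measurable Z₂)
    (hZ₁ : Measure.map Z₁ P = gaussianReal 0 1) (hZ₂ : Measure.map Z₂ P = gaussianReal 0 1)
    (hindep : IndepFun Z₁ Z₂ P) (a b : ℝ) {s : Set (ℝ × ℝ)} (hs : MeasurableSet s) :
    ∫ ω in {ω | (Z₁ ω, Z₂ ω) ∈ s},
        Real.exp (a * Z₁ ω - a ^ 2 / 2) * Real.exp (b * Z₂ ω - b ^ 2 / 2) ∂P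
      = P.real {ω | (Z₁ ω + a, Z₂ ω + b) ∈ s} := by
  have hm : Measurable (fun ω => (Z₁ ω, Z₂ ω)) := hmZ₁.prodMk hmZ₂
  have hs' : MeasurableSet {p : ℝ × ℝ | (p.1 + a, p.2 + b) ∈ s} :=
    hs.preimage (f := fun p : ℝ × ℝ => (p.1 + a, p.2 + b)) (by fun_prop)
  have h := setIntegral_exp_prod_gaussianReal a b hs
  rw [← map_prodMk_eq_prod_gaussianReal hmZ₁ hmZ₂ hZ₁ hZ₂ hindep,
    setIntegral_map hs (by fun_prop) hm.aemeasurable,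
    map_measureReal_apply hm hs'] at h
  exact h

end IndependentGaussians

/-- (Proposition 2.1) For `K > 0`, the spread option price
`Π_T = e^{-rT}·E[(S₁(T) - S₂(T) - K)⁺]` equals
`e^{-rT}·F₁·P(g₁F̄₁e^{σ₁√T Y} - ᾱF̄₂e^{σ₂√T X} - K ≥ 0)
 - e^{-rT}·F₂·P(ᾱF̄₁e^{σ₁√T Y} - g₂F̄₂e^{σ₂√T X} - K ≥ 0)
 - e^{-rT}·K·P(F̄₁e^{σ₁√T Y} - F̄₂e^{σ₂√T X} - K ≥ 0)`. -/
theorem spread_price_three_probabilities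
    {Ω : Type*} [MeasurableSpace Ω] (P : Measure Ω) [IsProbabilityMeasure P]
    (Z₁ Z₂ : Ω → ℝ) (hmZ₁ : Measurable Z₁) (hmZ₂ : Measurable Z₂)
    (hZ₁ : Measure.map Z₁ P = gaussianReal 0 1)
    (hZ₂ : Measure.map Z₂ P = gaussianReal 0 1)
    (hindep : IndepFun Z₁ Z₂ P)
    (ρ r T σ₁ σ₂ F₁ F₂ K : ℝ)
    (hρ₁ : -1 < ρ) (hρ₂ : ρ < 1) (hT : 0 < T)
    (hσ₁ : 0 < σ₁) (hσ₂ : 0 < σ₂) (hF₁ : 0 < F₁) (hF₂ : 0 < F₂) (hK : 0 < K)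
    (X Y : Ω → ℝ) (hX : X = Z₂)
    (hY : Y = fun ω => ρ * Z₂ ω + Real.sqrt (1 - ρ ^ 2) * Z₁ ω)
    (S₁ S₂ : Ω → ℝ)
    (hS₁ : S₁ = fun ω => F₁ * Real.exp (-(σ₁ ^ 2 * T) / 2 + σ₁ * Real.sqrt T * Y ω))
    (hS₂ : S₂ = fun ω => F₂ * Real.exp (-(σ₂ ^ 2 * T) / 2 + σ₂ * Real.sqrt T * X ω))
    (α g₁ g₂ Fb₁ Fb₂ : ℝ)
    (hα : α = Real.exp (ρ * σ₁ * σ₂ * T))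
    (hg₁ : g₁ = Real.exp (σ₁ ^ 2 * T))
    (hg₂ : g₂ = Real.exp (σ₂ ^ 2 * T))
    (hFb₁ : Fb₁ = F₁ * Real.exp (-(σ₁ ^ 2 * T) / 2))
    (hFb₂ : Fb₂ = F₂ * Real.exp (-(σ₂ ^ 2 * T) / 2)) :
    Real.exp (-(r * T)) * ∫ ω, max (S₁ ω - S₂ ω - K) 0 ∂P
      = Real.exp (-(r * T)) * F₁ *
          (P {ω | 0 ≤ g₁ * Fb₁ * Real.exp (σ₁ * Real.sqrt T * Y ω)
              - α * Fb₂ * Real.exp (σ₂ * Real.sqrt T * X ω) - K}).toReal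
        - Real.exp (-(r * T)) * F₂ *
          (P {ω | 0 ≤ α * Fb₁ * Real.exp (σ₁ * Real.sqrt T * Y ω)
              - g₂ * Fb₂ * Real.exp (σ₂ * Real.sqrt T * X ω) - K}).toReal
        - Real.exp (-(r * T)) * K *
          (P {ω | 0 ≤ Fb₁ * Real.exp (σ₁ * Real.sqrt T * Y ω)
              - Fb₂ * Real.exp (σ₂ * Real.sqrt T * X ω) - K}).toReal := by
  have hsq : Real.sqrt (1 - ρ ^ 2) ^ 2 = 1 - ρ ^ 2 := Real.sq_sqrt (by nlinarith)
  have hsqT : Real.sqrt T ^ 2 = T := Real.sq_sqrt hT.le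
  set c := Real.sqrt (1 - ρ ^ 2)
  set t := Real.sqrt T
  let s : Set (ℝ × ℝ) := {p | 0 ≤ Fb₁ * Real.exp (σ₁ * t * (ρ * p.2 + c * p.1))
    - Fb₂ * Real.exp (σ₂ * t * p.2) - K}
  have hs : MeasurableSet s := measurableSet_le (by fun_prop) (by fun_prop)
  let A : Set Ω := {ω | (Z₁ ω, Z₂ ω) ∈ s}
  have hA : MeasurableSet A := hs.preimage (hmZ₁.prodMk hmZ₂)
  have hS₁' (ω : Ω) : S₁ ω = F₁ * (Real.exp (σ₁ * t * c * Z₁ ω - (σ₁ * t * c) ^ 2 / 2)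
      * Real.exp (σ₁ * t * ρ * Z₂ ω - (σ₁ * t * ρ) ^ 2 / 2)) := by
    simp only [hS₁, hY, ← Real.exp_add]
    congr 2
    rw [← hsqT]
    linear_combination (σ₁ ^ 2 * t ^ 2 / 2) * hsq
  have hS₂' (ω : Ω) : S₂ ω = F₂ * (Real.exp (0 * Z₁ ω - 0 ^ 2 / 2)
      * Real.exp (σ₂ * t * Z₂ ω - (σ₂ * t) ^ 2 / 2)) := by
    simp only [hS₂, hX, ← Real.exp_add]
    congr 2
    rw [← hsqT]
    ring
  have hi₁ : Integrable S₁ P := by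
    rw [funext hS₁']
    exact (integrable_exp_of_indepFun_gaussianReal hmZ₁ hmZ₂ hZ₁ hZ₂ hindep _ _).const_mul _
  have hi₂ : Integrable S₂ P := by
    rw [funext hS₂']
    exact (integrable_exp_of_indepFun_gaussianReal hmZ₁ hmZ₂ hZ₁ hZ₂ hindep _ _).const_mul _
  have hmemA (ω : Ω) : ω ∈ A ↔ 0 ≤ S₁ ω - S₂ ω - K := by
    simp only [A, s, Set.mem_ofPred_eq, hS₁, hS₂, hX, hY, hFb₁, hFb₂, Real.exp_add, mul_assoc]
  have hmax : ∫ ω, max (S₁ ω - S₂ ω - K) 0 ∂P = ∫ ω in A, (S₁ ω - S₂ ω - K) ∂P := by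
    rw [← integral_indicator hA]
    congr 1 with ω
    by_cases h : ω ∈ A
    · rw [Set.indicator_of_mem h, max_eq_left ((hmemA ω).1 h)]
    · rw [Set.indicator_of_notMem h, max_eq_right (not_le.1 (mt (hmemA ω).2 h)).le]
  have hexp {u v w : ℝ} (h : u = v + w) : Real.exp u = Real.exp v * Real.exp w := by
    rw [h, Real.exp_add]
  have h₁ : ∫ ω in A, S₁ ω ∂P = F₁ * (P {ω | 0 ≤ g₁ * Fb₁ * Real.exp (σ₁ * t * Y ω)
      - α * Fb₂ * Real.exp (σ₂ * t * X ω) - K}).toReal := by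
    simp_rw [hS₁']
    rw [integral_const_mul,
      setIntegral_exp_of_indepFun_gaussianReal hmZ₁ hmZ₂ hZ₁ hZ₂ hindep _ _ hs, measureReal_def]
    congr 4 with ω
    have e₁ : Real.exp (σ₁ * t * (ρ * (Z₂ ω + σ₁ * t * ρ) + c * (Z₁ ω + σ₁ * t * c)))
        = g₁ * Real.exp (σ₁ * t * Y ω) := by
      rw [hg₁, hY]
      exact hexp (by linear_combination σ₁ ^ 2 * hsqT + σ₁ ^ 2 * t ^ 2 * hsq)
    have e₂ : Real.exp (σ₂ * t * (Z₂ ω + σ₁ * t * ρ)) = α * Real.exp (σ₂ * t * X ω) := by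
      rw [hα, hX]
      exact hexp (by linear_combination ρ * σ₁ * σ₂ * hsqT)
    simp only [s, Set.mem_ofPred_eq, e₁, e₂]
    ring_nf
  have h₂ : ∫ ω in A, S₂ ω ∂P = F₂ * (P {ω | 0 ≤ α * Fb₁ * Real.exp (σ₁ * t * Y ω)
      - g₂ * Fb₂ * Real.exp (σ₂ * t * X ω) - K}).toReal := by
    simp_rw [hS₂']
    rw [integral_const_mul,
      setIntegral_exp_of_indepFun_gaussianReal hmZ₁ hmZ₂ hZ₁ hZ₂ hindep _ _ hs, measureReal_def]
    congr 4 with ω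
    have e₁ : Real.exp (σ₁ * t * (ρ * (Z₂ ω + σ₂ * t) + c * (Z₁ ω + 0)))
        = α * Real.exp (σ₁ * t * Y ω) := by
      rw [hα, hY]
      exact hexp (by linear_combination ρ * σ₁ * σ₂ * hsqT)
    have e₂ : Real.exp (σ₂ * t * (Z₂ ω + σ₂ * t)) = g₂ * Real.exp (σ₂ * t * X ω) := by
      rw [hg₂, hX]
      exact hexp (by linear_combination σ₂ ^ 2 * hsqT)
    simp only [s, Set.mem_ofPred_eq, e₁, e₂]
    ring_nf
  have h₃ : ∫ _ in A, K ∂P = K * (P {ω | 0 ≤ Fb₁ * Real.exp (σ₁ * t * Y ω)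
      - Fb₂ * Real.exp (σ₂ * t * X ω) - K}).toReal := by
    rw [setIntegral_const, smul_eq_mul, mul_comm, hX, hY]
    rfl
  rw [hmax, integral_sub (f := fun ω => S₁ ω - S₂ ω) (hi₁.sub hi₂).integrableOn (integrable_const K),
    integral_sub hi₁.integrableOn hi₂.integrableOn, h₁, h₂, h₃]
  ring
end

section
/- (Corollary 2.2, Margrabe's formula) For K = 0, the exchange option price satisfies e^{-rT}·E[(S₁(T) - S₂(T))⁺] = e^{-rT}·F₁·Φ( ln(g₁F̄₁/(ᾱF̄₂)) / (√T·√(σ₁² + σ₂² - 2ρσ₁σ₂)) ) - e^{-rT}·F₂·Φ( ln(ᾱF̄₁/(g₂F̄₂)) / (√T·√(σ₁² + σ₂² - 2ρσ₁σ₂)) ). (Note σ₁² + σ₂² - 2ρσ₁σ₂ > 0 since |ρ| < 1.) -/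
open MeasureTheory ProbabilityTheory Real

/-- The standard normal cumulative distribution function Φ. -/
noncomputable def stdGaussianCDF (x : ℝ) : ℝ := ((gaussianReal 0 1) (Set.Iic x)).toReal

open scoped ENNReal NNReal

/-- One-dimensional Cameron–Martin formula for the standard Gaussian measure. -/
lemma gaussianReal_withDensity_exp (a : ℝ) :
    (gaussianReal 0 1).withDensity (fun x => ENNReal.ofReal (exp (-(a ^ 2) / 2 + a * x)))
      = gaussianReal a 1 := by
  rw [gaussianReal_of_var_ne_zero 0 one_ne_zero, gaussianReal_of_var_ne_zero a one_ne_zero,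
    ← withDensity_mul _ (measurable_gaussianPDF 0 1) (by fun_prop)]
  congr 1
  ext1 x
  rw [Pi.mul_apply, gaussianPDF, gaussianPDF, ← ENNReal.ofReal_mul (gaussianPDFReal_nonneg 0 1 x),
    gaussianPDFReal, gaussianPDFReal, mul_assoc, ← exp_add]
  congr 3
  simp only [NNReal.coe_one]
  ring

/-- Two-dimensional Cameron–Martin formula for the standard Gaussian measure, for the probability
of a measurable set. -/
lemma setIntegral_exp_gaussianReal_prod (a b : ℝ) {A : Set (ℝ × ℝ)} (hA : MeasurableSet A) :
    ∫ z in A, exp (-(a ^ 2 + b ^ 2) / 2 + (a * z.1 + b * z.2))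
        ∂((gaussianReal 0 1).prod (gaussianReal 0 1))
      = ((gaussianReal a 1).prod (gaussianReal b 1)).real A := by
  rw [integral_eq_lintegral_of_nonneg_ae (Filter.Eventually.of_forall fun _ => (exp_pos _).le)
      (by fun_prop),
    measureReal_def, ← gaussianReal_withDensity_exp a, ← gaussianReal_withDensity_exp b,
    prod_withDensity (by fun_prop) (by fun_prop), withDensity_apply _ hA]
  congr 1
  refine lintegral_congr fun z => ?_
  rw [← ENNReal.ofReal_mul (exp_pos _).le, ← exp_add]
  congr 2
  ring

lemma integrable_exp_gaussianReal_prod (a b : ℝ) :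
    Integrable (fun z : ℝ × ℝ => exp (-(a ^ 2 + b ^ 2) / 2 + (a * z.1 + b * z.2)))
      ((gaussianReal 0 1).prod (gaussianReal 0 1)) := by
  have h := ((integrable_exp_mul_gaussianReal (μ := 0) (v := 1) a).mul_prod
    (integrable_exp_mul_gaussianReal (μ := 0) (v := 1) b)).const_mul (exp (-(a ^ 2 + b ^ 2) / 2))
  refine h.congr (Filter.Eventually.of_forall fun z => ?_)
  simp only [← exp_add]

lemma gaussianReal_real_Ici (m c : ℝ) {v : ℝ≥0} (hv : v ≠ 0) :
    (gaussianReal m v).real (Set.Ici c) = stdGaussianCDF ((m - c) / √v) := by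
  have hs : 0 < √(v : ℝ) := Real.sqrt_pos.2 (by positivity)
  have hmap : (gaussianReal 0 1).map (fun x => m - √v * x) = gaussianReal m v := by
    have hcomp : (fun x => m - √v * x) = (fun x => m - x) ∘ (fun x => √(v : ℝ) * x) := rfl
    rw [hcomp, ← Measure.map_map (by fun_prop) (by fun_prop), gaussianReal_map_const_mul,
      gaussianReal_map_const_sub]
    congr 1
    · ring
    · ext
      simp
  rw [measureReal_def, ← hmap, Measure.map_apply (by fun_prop) measurableSet_Ici, stdGaussianCDF]
  congr 2
  ext x
  simp only [Set.mem_preimage, Set.mem_Ici, Set.mem_Iic, le_div_iff₀ hs]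
  constructor <;> intro h <;> linarith

/-- The mass of a half-plane under a product of Gaussian measures with unit variance. -/
lemma gaussianReal_prod_real_halfPlane (a b p q c : ℝ) (hpq : 0 < p ^ 2 + q ^ 2) :
    ((gaussianReal a 1).prod (gaussianReal b 1)).real {z | c ≤ p * z.1 + q * z.2}
      = stdGaussianCDF ((p * a + q * b - c) / √(p ^ 2 + q ^ 2)) := by
  set μ := (gaussianReal a 1).prod (gaussianReal b 1) with hμ
  have h₁ : μ.map (fun z => p * z.1) = gaussianReal (p * a) (.mk (p ^ 2) (sq_nonneg _) * 1) := by
    rw [← gaussianReal_map_const_mul,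
      show (fun z : ℝ × ℝ => p * z.1) = (fun x => p * x) ∘ Prod.fst from rfl,
      ← Measure.map_map (by fun_prop) measurable_fst, hμ, Measure.map_fst_prod, measure_univ,
      one_smul]
  have h₂ : μ.map (fun z => q * z.2) = gaussianReal (q * b) (.mk (q ^ 2) (sq_nonneg _) * 1) := by
    rw [← gaussianReal_map_const_mul,
      show (fun z : ℝ × ℝ => q * z.2) = (fun x => q * x) ∘ Prod.snd from rfl,
      ← Measure.map_map (by fun_prop) measurable_snd, hμ, Measure.map_snd_prod, measure_univ,
      one_smul]
  have h := gaussianReal_add_gaussianReal_of_indepFun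
    (indepFun_prod (μ := gaussianReal a 1) (ν := gaussianReal b 1)
      (measurable_const_mul p) (measurable_const_mul q)) h₁ h₂
  have hv : (.mk (p ^ 2) (sq_nonneg _) * 1 + .mk (q ^ 2) (sq_nonneg _) * 1 : ℝ≥0) ≠ 0 := by
    rw [← NNReal.coe_ne_zero]
    simpa using hpq.ne'
  have hI := gaussianReal_real_Ici (p * a + q * b) c hv
  rw [← h, measureReal_def, Measure.map_apply (by fun_prop) measurableSet_Ici] at hI
  simpa [measureReal_def, Set.preimage] using hI

/-- The expected positive part of the difference of two jointly log-normal variables, written in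
terms of two independent standard Gaussian coordinates. -/
lemma integral_max_exp_sub_exp_gaussianReal_prod (a₁ b₁ a₂ b₂ : ℝ) {F₁ F₂ : ℝ}
    (hF₁ : 0 < F₁) (hF₂ : 0 < F₂) (hne : 0 < (a₁ - a₂) ^ 2 + (b₁ - b₂) ^ 2) :
    ∫ z : ℝ × ℝ, max (F₁ * exp (-(a₁ ^ 2 + b₁ ^ 2) / 2 + (a₁ * z.1 + b₁ * z.2))
        - F₂ * exp (-(a₂ ^ 2 + b₂ ^ 2) / 2 + (a₂ * z.1 + b₂ * z.2))) 0
        ∂((gaussianReal 0 1).prod (gaussianReal 0 1))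
      = F₁ * stdGaussianCDF ((log (F₁ / F₂) + ((a₁ - a₂) ^ 2 + (b₁ - b₂) ^ 2) / 2)
            / √((a₁ - a₂) ^ 2 + (b₁ - b₂) ^ 2))
        - F₂ * stdGaussianCDF ((log (F₁ / F₂) - ((a₁ - a₂) ^ 2 + (b₁ - b₂) ^ 2) / 2)
            / √((a₁ - a₂) ^ 2 + (b₁ - b₂) ^ 2)) := by
  set c := -log (F₁ / F₂) + ((a₁ ^ 2 + b₁ ^ 2) - (a₂ ^ 2 + b₂ ^ 2)) / 2 with hc
  set A : Set (ℝ × ℝ) := {z | c ≤ (a₁ - a₂) * z.1 + (b₁ - b₂) * z.2} with hAdef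
  have hA : MeasurableSet A := measurableSet_le (by fun_prop) (by fun_prop)
  have hmem (z : ℝ × ℝ) : z ∈ A ↔ F₂ * exp (-(a₂ ^ 2 + b₂ ^ 2) / 2 + (a₂ * z.1 + b₂ * z.2))
      ≤ F₁ * exp (-(a₁ ^ 2 + b₁ ^ 2) / 2 + (a₁ * z.1 + b₁ * z.2)) := by
    rw [← log_le_log_iff (by positivity) (by positivity), log_mul hF₂.ne' (exp_pos _).ne',
      log_mul hF₁.ne' (exp_pos _).ne', log_exp, log_exp, hAdef, Set.mem_ofPred_eq, hc,
      log_div hF₁.ne' hF₂.ne']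
    constructor <;> intro h <;> linarith
  have hind (z : ℝ × ℝ) : max (F₁ * exp (-(a₁ ^ 2 + b₁ ^ 2) / 2 + (a₁ * z.1 + b₁ * z.2))
        - F₂ * exp (-(a₂ ^ 2 + b₂ ^ 2) / 2 + (a₂ * z.1 + b₂ * z.2))) 0
      = A.indicator (fun z => F₁ * exp (-(a₁ ^ 2 + b₁ ^ 2) / 2 + (a₁ * z.1 + b₁ * z.2))
        - F₂ * exp (-(a₂ ^ 2 + b₂ ^ 2) / 2 + (a₂ * z.1 + b₂ * z.2))) z := by
    by_cases hz : z ∈ A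
    · rw [Set.indicator_of_mem hz, max_eq_left (sub_nonneg.2 ((hmem z).1 hz))]
    · rw [Set.indicator_of_notMem hz, max_eq_right]
      exact sub_nonpos.2 (not_le.1 (mt (hmem z).2 hz)).le
  simp_rw [hind]
  rw [integral_indicator hA,
    integral_sub ((integrable_exp_gaussianReal_prod a₁ b₁).const_mul F₁).integrableOn
      ((integrable_exp_gaussianReal_prod a₂ b₂).const_mul F₂).integrableOn,
    integral_const_mul, integral_const_mul, setIntegral_exp_gaussianReal_prod _ _ hA,
    setIntegral_exp_gaussianReal_prod _ _ hA, gaussianReal_prod_real_halfPlane _ _ _ _ _ hne,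
    gaussianReal_prod_real_halfPlane _ _ _ _ _ hne]
  congr 4 <;> rw [hc] <;> ring

/-- (Corollary 2.2, Margrabe's formula) For `K = 0`, the exchange option price satisfies
`e^{-rT}·E[(S₁(T) - S₂(T))⁺]
  = e^{-rT}·F₁·Φ( ln(g₁F̄₁/(ᾱF̄₂)) / (√T·√(σ₁² + σ₂² - 2ρσ₁σ₂)) )
  - e^{-rT}·F₂·Φ( ln(ᾱF̄₁/(g₂F̄₂)) / (√T·√(σ₁² + σ₂² - 2ρσ₁σ₂)) )`. -/
theorem margrabe_formula
    {Ω : Type*} [MeasurableSpace Ω] (P : Measure Ω) [IsProbabilityMeasure P]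
    (Z₁ Z₂ : Ω → ℝ) (hmZ₁ : Measurable Z₁) (hmZ₂ : Measurable Z₂)
    (hZ₁ : Measure.map Z₁ P = gaussianReal 0 1)
    (hZ₂ : Measure.map Z₂ P = gaussianReal 0 1)
    (hindep : IndepFun Z₁ Z₂ P)
    (ρ r T σ₁ σ₂ F₁ F₂ : ℝ)
    (hρ₁ : -1 < ρ) (hρ₂ : ρ < 1) (hT : 0 < T)
    (hσ₁ : 0 < σ₁) (hσ₂ : 0 < σ₂) (hF₁ : 0 < F₁) (hF₂ : 0 < F₂)
    (X Y : Ω → ℝ) (hX : X = Z₂)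
    (hY : Y = fun ω => ρ * Z₂ ω + Real.sqrt (1 - ρ ^ 2) * Z₁ ω)
    (S₁ S₂ : Ω → ℝ)
    (hS₁ : S₁ = fun ω => F₁ * Real.exp (-(σ₁ ^ 2 * T) / 2 + σ₁ * Real.sqrt T * Y ω))
    (hS₂ : S₂ = fun ω => F₂ * Real.exp (-(σ₂ ^ 2 * T) / 2 + σ₂ * Real.sqrt T * X ω))
    (α g₁ g₂ Fb₁ Fb₂ : ℝ)
    (hα : α = Real.exp (ρ * σ₁ * σ₂ * T))
    (hg₁ : g₁ = Real.exp (σ₁ ^ 2 * T))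
    (hg₂ : g₂ = Real.exp (σ₂ ^ 2 * T))
    (hFb₁ : Fb₁ = F₁ * Real.exp (-(σ₁ ^ 2 * T) / 2))
    (hFb₂ : Fb₂ = F₂ * Real.exp (-(σ₂ ^ 2 * T) / 2)) :
    Real.exp (-(r * T)) * ∫ ω, max (S₁ ω - S₂ ω) 0 ∂P
      = Real.exp (-(r * T)) * F₁ *
          stdGaussianCDF (Real.log (g₁ * Fb₁ / (α * Fb₂)) /
            (Real.sqrt T * Real.sqrt (σ₁ ^ 2 + σ₂ ^ 2 - 2 * ρ * σ₁ * σ₂)))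
        - Real.exp (-(r * T)) * F₂ *
          stdGaussianCDF (Real.log (α * Fb₁ / (g₂ * Fb₂)) /
            (Real.sqrt T * Real.sqrt (σ₁ ^ 2 + σ₂ ^ 2 - 2 * ρ * σ₁ * σ₂))) := by
  subst hX hY hS₁ hS₂ hα hg₁ hg₂ hFb₁ hFb₂
  have hρ : 0 < 1 - ρ ^ 2 := by nlinarith
  have hsT : √T ^ 2 = T := sq_sqrt hT.le
  have hsρ : √(1 - ρ ^ 2) ^ 2 = 1 - ρ ^ 2 := sq_sqrt hρ.le
  have hvar : 0 < σ₁ ^ 2 + σ₂ ^ 2 - 2 * ρ * σ₁ * σ₂ := by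
    nlinarith [sq_nonneg (σ₂ - ρ * σ₁), mul_pos hρ (pow_pos hσ₁ 2)]
  have hlaw : P.map (fun ω => (Z₁ ω, X ω)) = (gaussianReal 0 1).prod (gaussianReal 0 1) := by
    rw [hindep.map_prod_eq_prod_map_map hmZ₁.aemeasurable hmZ₂.aemeasurable, hZ₁, hZ₂]
  set a₁ := σ₁ * √T * √(1 - ρ ^ 2) with ha₁
  set b₁ := σ₁ * √T * ρ with hb₁
  set b₂ := σ₂ * √T with hb₂
  have hn₁ : a₁ ^ 2 + b₁ ^ 2 = σ₁ ^ 2 * T := by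
    rw [ha₁, hb₁, mul_pow, mul_pow, mul_pow, mul_pow, hsT, hsρ]
    ring
  have hn₂ : 0 ^ 2 + b₂ ^ 2 = σ₂ ^ 2 * T := by
    rw [hb₂, mul_pow, hsT]
    ring
  have hd : (a₁ - 0) ^ 2 + (b₁ - b₂) ^ 2 = T * (σ₁ ^ 2 + σ₂ ^ 2 - 2 * ρ * σ₁ * σ₂) := by
    have hcross : b₁ * b₂ = ρ * σ₁ * σ₂ * T := by
      rw [hb₁, hb₂]
      linear_combination (ρ * σ₁ * σ₂) * hsT
    linear_combination hn₁ + hn₂ - 2 * hcross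
  have key := integral_max_exp_sub_exp_gaussianReal_prod a₁ b₁ 0 b₂ hF₁ hF₂
    (by rw [hd]; exact mul_pos hT hvar)
  rw [← hlaw, integral_map (by fun_prop) (by fun_prop), hn₁, hn₂, hd, sqrt_mul hT.le] at key
  have hpayoff : ∫ ω, max (F₁ * exp (-(σ₁ ^ 2 * T) / 2
        + σ₁ * √T * (ρ * X ω + √(1 - ρ ^ 2) * Z₁ ω))
        - F₂ * exp (-(σ₂ ^ 2 * T) / 2 + σ₂ * √T * X ω)) 0 ∂P
      = ∫ ω, max (F₁ * exp (-(σ₁ ^ 2 * T) / 2 + (a₁ * Z₁ ω + b₁ * X ω))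
        - F₂ * exp (-(σ₂ ^ 2 * T) / 2 + (0 * Z₁ ω + b₂ * X ω))) 0 ∂P := by
    refine integral_congr_ae (Filter.Eventually.of_forall fun ω => ?_)
    simp only [ha₁, hb₁, hb₂]
    ring_nf
  have hlog₁ : log (exp (σ₁ ^ 2 * T) * (F₁ * exp (-(σ₁ ^ 2 * T) / 2))
        / (exp (ρ * σ₁ * σ₂ * T) * (F₂ * exp (-(σ₂ ^ 2 * T) / 2))))
      = log (F₁ / F₂) + T * (σ₁ ^ 2 + σ₂ ^ 2 - 2 * ρ * σ₁ * σ₂) / 2 := by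
    rw [log_div (by positivity) (by positivity), log_mul (by positivity) (by positivity),
      log_mul (by positivity) (by positivity), log_mul (by positivity) (by positivity),
      log_mul (by positivity) (by positivity), log_div hF₁.ne' hF₂.ne']
    simp only [log_exp]
    ring
  have hlog₂ : log (exp (ρ * σ₁ * σ₂ * T) * (F₁ * exp (-(σ₁ ^ 2 * T) / 2))
        / (exp (σ₂ ^ 2 * T) * (F₂ * exp (-(σ₂ ^ 2 * T) / 2))))
      = log (F₁ / F₂) - T * (σ₁ ^ 2 + σ₂ ^ 2 - 2 * ρ * σ₁ * σ₂) / 2 := by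
    rw [log_div (by positivity) (by positivity), log_mul (by positivity) (by positivity),
      log_mul (by positivity) (by positivity), log_mul (by positivity) (by positivity),
      log_mul (by positivity) (by positivity), log_div hF₁.ne' hF₂.ne']
    simp only [log_exp]
    ring
  rw [hpayoff, key, hlog₁, hlog₂]
  ring
end

section
/- (Measure-change identity, second term of the proof of Proposition 2.1) For K > 0, E[ exp(-σ₂²T/2 + σ₂√T·X) · 1_{S₁(T) - S₂(T) - K ≥ 0} ] = P( ᾱF̄₁·e^{σ₁√T·Y} - g₂F̄₂·e^{σ₂√T·X} - K ≥ 0 ). -/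
open MeasureTheory ProbabilityTheory Real

/-- Exponentially tilting the standard Gaussian by `s` amounts to translating it by `s`. -/
lemma lintegral_exp_mul_gaussianReal (s : ℝ) {f : ℝ → ENNReal} (hf : Measurable f) :
    ∫⁻ x, ENNReal.ofReal (Real.exp (-s ^ 2 / 2 + s * x)) * f x ∂(gaussianReal 0 1)
      = ∫⁻ x, f (x + s) ∂(gaussianReal 0 1) := by
  rw [gaussianReal_of_var_ne_zero _ one_ne_zero,
    lintegral_withDensity_eq_lintegral_mul _ (measurable_gaussianPDF 0 1) (by fun_prop),
    lintegral_withDensity_eq_lintegral_mul _ (measurable_gaussianPDF 0 1) (by fun_prop),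
    ← lintegral_add_right_eq_self _ s]
  refine lintegral_congr fun x => ?_
  simp only [Pi.mul_apply, gaussianPDF]
  rw [← mul_assoc, ← ENNReal.ofReal_mul (gaussianPDFReal_nonneg _ _ _)]
  congr 2
  simp only [gaussianPDFReal, mul_assoc, ← Real.exp_add]
  congr 3
  push_cast
  ring

/-- The translation identity for a pair of independent standard Gaussians, tilting the second. -/
lemma setIntegral_exp_eq_measureReal_of_indepFun_gaussianReal
    {Ω : Type*} [MeasurableSpace Ω] {P : Measure Ω} [IsProbabilityMeasure P]
    {Z₁ Z₂ : Ω → ℝ} (hmZ₁ : Measurable Z₁) (hmZ₂ : Measurable Z₂)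
    (hZ₁ : Measure.map Z₁ P = gaussianReal 0 1) (hZ₂ : Measure.map Z₂ P = gaussianReal 0 1)
    (hindep : IndepFun Z₁ Z₂ P) (s : ℝ) {A : Set (ℝ × ℝ)} (hA : MeasurableSet A) :
    ∫ ω in {ω | (Z₁ ω, Z₂ ω) ∈ A}, Real.exp (-s ^ 2 / 2 + s * Z₂ ω) ∂P
      = (P {ω | (Z₁ ω, Z₂ ω + s) ∈ A}).toReal := by
  have hlaw : P.map (fun ω => (Z₁ ω, Z₂ ω)) = (gaussianReal 0 1).prod (gaussianReal 0 1) := by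
    rw [(indepFun_iff_map_prod_eq_prod_map_map hmZ₁.aemeasurable hmZ₂.aemeasurable).1 hindep,
      hZ₁, hZ₂]
  have hm : Measurable fun ω => (Z₁ ω, Z₂ ω) := hmZ₁.prodMk hmZ₂
  have hind : Measurable (A.indicator (1 : ℝ × ℝ → ENNReal)) := measurable_one.indicator hA
  have hshift : Measurable fun p : ℝ × ℝ => A.indicator (1 : ℝ × ℝ → ENNReal) (p.1, p.2 + s) :=
    hind.comp (by fun_prop)
  have hpre : MeasurableSet {ω | (Z₁ ω, Z₂ ω) ∈ A} := hm hA
  have hpre' : MeasurableSet {ω | (Z₁ ω, Z₂ ω + s) ∈ A} := hmZ₁.prodMk (hmZ₂.add_const s) hA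
  have hweight : Measurable fun p : ℝ × ℝ =>
      ENNReal.ofReal (Real.exp (-s ^ 2 / 2 + s * p.2)) * A.indicator 1 p :=
    Measurable.mul (by fun_prop) hind
  rw [integral_eq_lintegral_of_nonneg_ae (ae_of_all _ fun _ => (Real.exp_pos _).le)
    (by fun_prop)]
  congr 1
  calc
    _ = ∫⁻ ω, ENNReal.ofReal (Real.exp (-s ^ 2 / 2 + s * Z₂ ω)) *
          A.indicator 1 (Z₁ ω, Z₂ ω) ∂P := by
      rw [← lintegral_indicator hpre]
      refine lintegral_congr fun ω => ?_
      by_cases h : (Z₁ ω, Z₂ ω) ∈ A <;> simp [Set.indicator, h]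
    _ = ∫⁻ p, ENNReal.ofReal (Real.exp (-s ^ 2 / 2 + s * p.2)) * A.indicator 1 p
          ∂((gaussianReal 0 1).prod (gaussianReal 0 1)) := by
      rw [← hlaw, lintegral_map hweight hm]
    _ = ∫⁻ p, A.indicator 1 (p.1, p.2 + s) ∂((gaussianReal 0 1).prod (gaussianReal 0 1)) := by
      rw [lintegral_prod _ hweight.aemeasurable, lintegral_prod _ hshift.aemeasurable]
      exact lintegral_congr fun x =>
        lintegral_exp_mul_gaussianReal s (hind.comp measurable_prodMk_left)
    _ = ∫⁻ ω, A.indicator 1 (Z₁ ω, Z₂ ω + s) ∂P := by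
      rw [← hlaw, lintegral_map hshift hm]
    _ = _ := by
      rw [← lintegral_indicator_one hpre']
      rfl

/-- (Measure-change identity, second term of the proof of Proposition 2.1) For `K > 0`,
`E[ exp(-σ₂²T/2 + σ₂√T·X) · 1_{S₁(T) - S₂(T) - K ≥ 0} ]
  = P( ᾱF̄₁·e^{σ₁√T·Y} - g₂F̄₂·e^{σ₂√T·X} - K ≥ 0 )`. -/
theorem measure_change_second_term
    {Ω : Type*} [MeasurableSpace Ω] (P : Measure Ω) [IsProbabilityMeasure P]
    (Z₁ Z₂ : Ω → ℝ) (hmZ₁ : Measurable Z₁) (hmZ₂ : Measurable Z₂)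
    (hZ₁ : Measure.map Z₁ P = gaussianReal 0 1)
    (hZ₂ : Measure.map Z₂ P = gaussianReal 0 1)
    (hindep : IndepFun Z₁ Z₂ P)
    (ρ T σ₁ σ₂ F₁ F₂ K : ℝ)
    (hρ₁ : -1 < ρ) (hρ₂ : ρ < 1) (hT : 0 < T)
    (hσ₁ : 0 < σ₁) (hσ₂ : 0 < σ₂) (hF₁ : 0 < F₁) (hF₂ : 0 < F₂) (hK : 0 < K)
    (X Y : Ω → ℝ) (hX : X = Z₂)
    (hY : Y = fun ω => ρ * Z₂ ω + Real.sqrt (1 - ρ ^ 2) * Z₁ ω)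
    (S₁ S₂ : Ω → ℝ)
    (hS₁ : S₁ = fun ω => F₁ * Real.exp (-(σ₁ ^ 2 * T) / 2 + σ₁ * Real.sqrt T * Y ω))
    (hS₂ : S₂ = fun ω => F₂ * Real.exp (-(σ₂ ^ 2 * T) / 2 + σ₂ * Real.sqrt T * X ω))
    (α g₂ Fb₁ Fb₂ : ℝ)
    (hα : α = Real.exp (ρ * σ₁ * σ₂ * T))
    (hg₂ : g₂ = Real.exp (σ₂ ^ 2 * T))
    (hFb₁ : Fb₁ = F₁ * Real.exp (-(σ₁ ^ 2 * T) / 2))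
    (hFb₂ : Fb₂ = F₂ * Real.exp (-(σ₂ ^ 2 * T) / 2)) :
    ∫ ω in {ω | 0 ≤ S₁ ω - S₂ ω - K},
        Real.exp (-(σ₂ ^ 2 * T) / 2 + σ₂ * Real.sqrt T * X ω) ∂P
      = (P {ω | 0 ≤ α * Fb₁ * Real.exp (σ₁ * Real.sqrt T * Y ω)
          - g₂ * Fb₂ * Real.exp (σ₂ * Real.sqrt T * X ω) - K}).toReal := by
  subst hX hY hS₁ hS₂ hα hg₂ hFb₁ hFb₂
  have hsq : Real.sqrt T * Real.sqrt T = T := Real.mul_self_sqrt hT.le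
  have hs : -(σ₂ ^ 2 * T) / 2 = -(σ₂ * Real.sqrt T) ^ 2 / 2 := by
    rw [mul_pow, Real.sq_sqrt hT.le]
  have hA : MeasurableSet {p : ℝ × ℝ |
      0 ≤ F₁ * Real.exp (-(σ₁ ^ 2 * T) / 2 + σ₁ * Real.sqrt T *
          (ρ * p.2 + Real.sqrt (1 - ρ ^ 2) * p.1))
        - F₂ * Real.exp (-(σ₂ ^ 2 * T) / 2 + σ₂ * Real.sqrt T * p.2) - K} :=
    measurableSet_le measurable_const (by fun_prop)
  have key := setIntegral_exp_eq_measureReal_of_indepFun_gaussianReal hmZ₁ hmZ₂ hZ₁ hZ₂ hindep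
    (σ₂ * Real.sqrt T) hA
  rw [← hs] at key
  refine key.trans ?_
  congr 2
  ext ω
  have h₁ : Real.exp (-(σ₁ ^ 2 * T) / 2 + σ₁ * Real.sqrt T *
        (ρ * (X ω + σ₂ * Real.sqrt T) + Real.sqrt (1 - ρ ^ 2) * Z₁ ω))
      = Real.exp (ρ * σ₁ * σ₂ * T) * Real.exp (-(σ₁ ^ 2 * T) / 2) *
        Real.exp (σ₁ * Real.sqrt T * (ρ * X ω + Real.sqrt (1 - ρ ^ 2) * Z₁ ω)) := by
    rw [← Real.exp_add, ← Real.exp_add]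
    congr 1
    linear_combination ρ * σ₁ * σ₂ * hsq
  have h₂ : Real.exp (-(σ₂ ^ 2 * T) / 2 + σ₂ * Real.sqrt T * (X ω + σ₂ * Real.sqrt T))
      = Real.exp (σ₂ ^ 2 * T) * Real.exp (-(σ₂ ^ 2 * T) / 2) *
        Real.exp (σ₂ * Real.sqrt T * X ω) := by
    rw [← Real.exp_add, ← Real.exp_add]
    congr 1
    linear_combination σ₂ ^ 2 * hsq
  simp only [Set.mem_ofPred_eq, h₁, h₂]
  ring_nf
end

section
/- (Closed form of the Carmona–Durrleman lower bound, equation (16) of the paper) Let φ₀ ∈ (0,π) with cos φ₀ = ρ, so that Y = Z₁·sin φ₀ + Z₂·cos φ₀ and X = Z₂. For θ ∈ ℝ define Y_θ = Z₁·sin θ - Z₂·cos θ. Then for all θ, d ∈ ℝ and K ∈ ℝ, E[ (S₁(T) - S₂(T) - K) · 1_{Y_θ ≤ d} ] = F₁·Φ(d + σ₁√T·cos(θ + φ₀)) - F₂·Φ(d + σ₂√T·cos θ) - K·Φ(d). -/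
open MeasureTheory ProbabilityTheory Real

/-- A random variable with the moment-generating function of a Gaussian is Gaussian. -/
lemma map_eq_gaussianReal_of_mgf {Ω : Type*} [MeasurableSpace Ω] {P : Measure Ω}
    [IsProbabilityMeasure P] {X : Ω → ℝ} (hX : AEMeasurable X P) {m : ℝ} {v : NNReal}
    (h : ∀ t, mgf X P t = exp (m * t + v * t ^ 2 / 2)) :
    P.map X = gaussianReal m v := by
  have hmgf : mgf X P = mgf id (gaussianReal m v) := by
    rw [mgf_id_gaussianReal]
    exact funext h
  have hset : integrableExpSet X P = Set.univ := by
    rw [integrableExpSet_eq_of_mgf hmgf, integrableExpSet_id_gaussianReal]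
  have hcomplex : complexMGF X P = complexMGF id (gaussianReal m v) :=
    funext fun z ↦ eqOn_complexMGF_of_mgf hmgf (by simp [hset])
  simpa using Measure.ext_of_complexMGF_eq hX aemeasurable_id hcomplex

section GaussianPair

variable {Ω : Type*} [MeasurableSpace Ω] {P : Measure Ω} {Z₁ Z₂ : Ω → ℝ}

lemma integral_exp_linear_gaussian_pair (hmZ₁ : Measurable Z₁) (hmZ₂ : Measurable Z₂)
    (hZ₁ : P.map Z₁ = gaussianReal 0 1) (hZ₂ : P.map Z₂ = gaussianReal 0 1)
    (hindep : IndepFun Z₁ Z₂ P) (p q : ℝ) :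
    ∫ ω, exp (p * Z₁ ω + q * Z₂ ω) ∂P = exp ((p ^ 2 + q ^ 2) / 2) := by
  have hindep' : IndepFun (fun ω ↦ exp (p * Z₁ ω)) (fun ω ↦ exp (q * Z₂ ω)) P :=
    hindep.exp_mul p q
  have h₁ := mgf_gaussianReal hZ₁ p
  have h₂ := mgf_gaussianReal hZ₂ q
  simp only [mgf] at h₁ h₂
  simp_rw [exp_add]
  rw [hindep'.integral_fun_mul_eq_mul_integral (by fun_prop) (by fun_prop), h₁, h₂, ← exp_add]
  congr 1
  push_cast
  ring

lemma integrable_exp_linear_gaussian_pair (hmZ₁ : Measurable Z₁) (hmZ₂ : Measurable Z₂)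
    (hZ₁ : P.map Z₁ = gaussianReal 0 1) (hZ₂ : P.map Z₂ = gaussianReal 0 1)
    (hindep : IndepFun Z₁ Z₂ P) (p q : ℝ) :
    Integrable (fun ω ↦ exp (p * Z₁ ω + q * Z₂ ω)) P :=
  .of_integral_ne_zero <| by
    rw [integral_exp_linear_gaussian_pair hmZ₁ hmZ₂ hZ₁ hZ₂ hindep]
    positivity

variable [IsProbabilityMeasure P]

/-- Exponential tilting shifts the mean of a linear form in a standard Gaussian pair. -/
lemma map_tilted_linear_gaussian_pair (hmZ₁ : Measurable Z₁) (hmZ₂ : Measurable Z₂)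
    (hZ₁ : P.map Z₁ = gaussianReal 0 1) (hZ₂ : P.map Z₂ = gaussianReal 0 1)
    (hindep : IndepFun Z₁ Z₂ P) (p q : ℝ) {r s : ℝ} (hrs : r ^ 2 + s ^ 2 = 1) :
    (P.tilted fun ω ↦ p * Z₁ ω + q * Z₂ ω).map (fun ω ↦ r * Z₁ ω + s * Z₂ ω) =
      gaussianReal (p * r + q * s) 1 := by
  have := isProbabilityMeasure_tilted
    (integrable_exp_linear_gaussian_pair hmZ₁ hmZ₂ hZ₁ hZ₂ hindep p q)
  refine map_eq_gaussianReal_of_mgf (by fun_prop) fun t ↦ ?_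
  rw [mgf, integral_tilted, integral_exp_linear_gaussian_pair hmZ₁ hmZ₂ hZ₁ hZ₂ hindep]
  have hexp (ω : Ω) : (exp (p * Z₁ ω + q * Z₂ ω) / exp ((p ^ 2 + q ^ 2) / 2)) •
      exp (t * (r * Z₁ ω + s * Z₂ ω)) =
      exp ((p + t * r) * Z₁ ω + (q + t * s) * Z₂ ω) * exp (-((p ^ 2 + q ^ 2) / 2)) := by
    rw [smul_eq_mul, ← exp_sub, ← exp_add, ← exp_add]
    ring_nf
  simp_rw [hexp]
  rw [integral_mul_const, integral_exp_linear_gaussian_pair hmZ₁ hmZ₂ hZ₁ hZ₂ hindep, ← exp_add]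
  congr 1
  push_cast
  linear_combination t ^ 2 / 2 * hrs

lemma gaussianReal_Iic_toReal (m d : ℝ) :
    ((gaussianReal m 1) (Set.Iic d)).toReal = stdGaussianCDF (d - m) := by
  have hmap := gaussianReal_map_add_const (μ := 0) (v := 1) m
  rw [zero_add] at hmap
  rw [← hmap, Measure.map_apply (by fun_prop) measurableSet_Iic, stdGaussianCDF]
  congr 2
  ext x
  simp [le_sub_iff_add_le]

lemma setIntegral_exp_linear_gaussian_pair (hmZ₁ : Measurable Z₁) (hmZ₂ : Measurable Z₂)
    (hZ₁ : P.map Z₁ = gaussianReal 0 1) (hZ₂ : P.map Z₂ = gaussianReal 0 1)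
    (hindep : IndepFun Z₁ Z₂ P) (p q : ℝ) {r s : ℝ} (hrs : r ^ 2 + s ^ 2 = 1) (d : ℝ) :
    ∫ ω in {ω | r * Z₁ ω + s * Z₂ ω ≤ d},
        exp (-(p ^ 2 + q ^ 2) / 2 + (p * Z₁ ω + q * Z₂ ω)) ∂P =
      stdGaussianCDF (d - (p * r + q * s)) := by
  rw [← gaussianReal_Iic_toReal,
    ← map_tilted_linear_gaussian_pair hmZ₁ hmZ₂ hZ₁ hZ₂ hindep p q hrs,
    Measure.map_apply (by fun_prop) measurableSet_Iic, tilted_apply_eq_ofReal_integral,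
    ENNReal.toReal_ofReal (integral_nonneg fun ω ↦ by positivity),
    integral_exp_linear_gaussian_pair hmZ₁ hmZ₂ hZ₁ hZ₂ hindep]
  simp_rw [← exp_sub]
  refine integral_congr_ae (.of_forall fun ω ↦ ?_)
  ring_nf

end GaussianPair

/-- (Closed form of the Carmona–Durrleman lower bound, equation (16) of the paper)
With `Y = Z₁ sin φ₀ + Z₂ cos φ₀` (where `cos φ₀ = ρ`, `φ₀ ∈ (0,π)`) and
`Y_θ = Z₁ sin θ - Z₂ cos θ`, for all `θ, d ∈ ℝ` and `K ∈ ℝ`,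
`E[(S₁(T) - S₂(T) - K)·1_{Y_θ ≤ d}]
  = F₁·Φ(d + σ₁√T·cos(θ + φ₀)) - F₂·Φ(d + σ₂√T·cos θ) - K·Φ(d)`. -/
theorem carmona_durrleman_lower_bound_closed_form
    {Ω : Type*} [MeasurableSpace Ω] (P : Measure Ω) [IsProbabilityMeasure P]
    (Z₁ Z₂ : Ω → ℝ) (hmZ₁ : Measurable Z₁) (hmZ₂ : Measurable Z₂)
    (hZ₁ : Measure.map Z₁ P = gaussianReal 0 1)
    (hZ₂ : Measure.map Z₂ P = gaussianReal 0 1)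
    (hindep : IndepFun Z₁ Z₂ P)
    (ρ T σ₁ σ₂ F₁ F₂ : ℝ)
    (hρ₁ : -1 < ρ) (hρ₂ : ρ < 1) (hT : 0 < T)
    (hσ₁ : 0 < σ₁) (hσ₂ : 0 < σ₂) (hF₁ : 0 < F₁) (hF₂ : 0 < F₂)
    (φ₀ : ℝ) (hφ₀ : φ₀ ∈ Set.Ioo 0 Real.pi) (hcos : Real.cos φ₀ = ρ)
    (X Y : Ω → ℝ) (hX : X = Z₂)
    (hY : Y = fun ω => Z₁ ω * Real.sin φ₀ + Z₂ ω * Real.cos φ₀)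
    (S₁ S₂ : Ω → ℝ)
    (hS₁ : S₁ = fun ω => F₁ * Real.exp (-(σ₁ ^ 2 * T) / 2 + σ₁ * Real.sqrt T * Y ω))
    (hS₂ : S₂ = fun ω => F₂ * Real.exp (-(σ₂ ^ 2 * T) / 2 + σ₂ * Real.sqrt T * X ω))
    (θ d K : ℝ) :
    ∫ ω in {ω | Z₁ ω * Real.sin θ - Z₂ ω * Real.cos θ ≤ d}, (S₁ ω - S₂ ω - K) ∂P
      = F₁ * stdGaussianCDF (d + σ₁ * Real.sqrt T * Real.cos (θ + φ₀))
        - F₂ * stdGaussianCDF (d + σ₂ * Real.sqrt T * Real.cos θ)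
        - K * stdGaussianCDF d := by
  subst hX hY hS₁ hS₂
  have hrs : sin θ ^ 2 + (-cos θ) ^ 2 = 1 := by rw [neg_sq, sin_sq_add_cos_sq]
  have hint := integrable_exp_linear_gaussian_pair hmZ₁ hmZ₂ hZ₁ hZ₂ hindep
  have hset := fun p q ↦ setIntegral_exp_linear_gaussian_pair hmZ₁ hmZ₂ hZ₁ hZ₂ hindep p q hrs d
  have hevent : {ω | Z₁ ω * sin θ - X ω * cos θ ≤ d} =
      {ω | sin θ * Z₁ ω + -cos θ * X ω ≤ d} := by
    ext ω
    simp only [Set.mem_ofPred_eq]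
    ring_nf
  rw [hevent]
  set A := {ω | sin θ * Z₁ ω + -cos θ * X ω ≤ d}
  have hdrift (σ α : ℝ) (ω : Ω) :
      -(σ ^ 2 * T) / 2 + σ * √T * (Z₁ ω * sin α + X ω * cos α) =
      -((σ * √T * sin α) ^ 2 + (σ * √T * cos α) ^ 2) / 2 +
        (σ * √T * sin α * Z₁ ω + σ * √T * cos α * X ω) := by
    linear_combination σ ^ 2 / 2 * sq_sqrt hT.le +
      σ ^ 2 * √T ^ 2 / 2 * sin_sq_add_cos_sq α
  have hvalue (σ α : ℝ) :
      ∫ ω in A, exp (-(σ ^ 2 * T) / 2 + σ * √T * (Z₁ ω * sin α + X ω * cos α)) ∂P =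
        stdGaussianCDF (d + σ * √T * cos (θ + α)) := by
    simp_rw [hdrift]
    rw [hset, cos_add]
    congr 1
    ring
  have hintegrable (σ α : ℝ) : Integrable
      (fun ω ↦ exp (-(σ ^ 2 * T) / 2 + σ * √T * (Z₁ ω * sin α + X ω * cos α))) P := by
    simp_rw [hdrift, exp_add (-_ / 2)]
    exact (hint _ _).const_mul _
  have hconst : ∫ _ in A, K ∂P = K * stdGaussianCDF d := by
    have h := hset 0 0
    simp only [ne_eq, OfNat.ofNat_ne_zero, not_false_eq_true, zero_pow, add_zero, neg_zero,
      zero_div, zero_mul, exp_zero, sub_zero] at h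
    rw [← h, ← integral_const_mul, mul_one]
  have hvalue₂ := hvalue σ₂ 0
  have hintegrable₂ := hintegrable σ₂ 0
  simp only [sin_zero, cos_zero, mul_zero, mul_one, zero_add, add_zero] at hvalue₂ hintegrable₂
  have hI₁ := ((hintegrable σ₁ φ₀).const_mul F₁).integrableOn (s := A)
  have hI₂ := (hintegrable₂.const_mul F₂).integrableOn (s := A)
  beta_reduce
  rw [integral_sub (by exact hI₁.sub hI₂) (integrable_const K), integral_sub hI₁ hI₂, integral_const_mul,
    integral_const_mul, hvalue, hvalue₂, hconst]
end

section
/- (Proposition 3.2, event identity) Let φ₀ ∈ (0,π) with cos φ₀ = ρ, and set ε₁ = Z₁·sin φ₀ - Z₂·cos φ₀ and ε₂ = -Z₂ (so ε₁, ε₂ are standard normal with Cov(ε₁,ε₂) = ρ). Let S₁(T) = F₁·exp(-σ₁²T/2 + σ₁√T·ε₁), S₂(T) = F₂·exp(-σ₂²T/2 + σ₂√T·ε₂), and for θ ∈ ℝ let Y_θ = Z₁·sin θ - Z₂·cos θ. Fix a > 0 and b ∈ ℝ, and set σ̄ = √(σ₁² + σ₂²b² - 2σ₁σ₂b·cos φ₀)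 (which is positive since |ρ| < 1). Define θ₀ by sin θ₀ = -σ₁·sin φ₀ / σ̄ and cos θ₀ = (σ₂b - σ₁·cos φ₀)/σ̄, and d₀ = ( ln(F₁/a) - σ₁²T/2 + bσ₂²T/2 ) / (σ̄√T). Then the events coincide: {Y_{θ₀} ≤ d₀} = { S₁(T) ≥ a·S₂(T)^b / F₂^b } (note F₂^b = E[S₂(T)]^b). -/
open MeasureTheory ProbabilityTheory Real

/-- (Proposition 3.2, event identity) With `ε₁ = Z₁ sin φ₀ - Z₂ cos φ₀`, `ε₂ = -Z₂`,
`S₁(T) = F₁·exp(-σ₁²T/2 + σ₁√T·ε₁)`, `S₂(T) = F₂·exp(-σ₂²T/2 + σ₂√T·ε₂)`,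
`Y_θ = Z₁ sin θ - Z₂ cos θ`, `σ̄ = √(σ₁² + σ₂²b² - 2σ₁σ₂b cos φ₀)`, `θ₀` defined by
`sin θ₀ = -σ₁ sin φ₀/σ̄`, `cos θ₀ = (σ₂b - σ₁ cos φ₀)/σ̄`, and
`d₀ = (ln(F₁/a) - σ₁²T/2 + bσ₂²T/2)/(σ̄√T)`, the events coincide:
`{Y_{θ₀} ≤ d₀} = {S₁(T) ≥ a·S₂(T)^b / F₂^b}`. -/
theorem bjerksund_stensland_event_identity
    {Ω : Type*} [MeasurableSpace Ω] (P : Measure Ω) [IsProbabilityMeasure P]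
    (Z₁ Z₂ : Ω → ℝ) (hmZ₁ : Measurable Z₁) (hmZ₂ : Measurable Z₂)
    (hZ₁ : Measure.map Z₁ P = gaussianReal 0 1)
    (hZ₂ : Measure.map Z₂ P = gaussianReal 0 1)
    (hindep : IndepFun Z₁ Z₂ P)
    (ρ T σ₁ σ₂ F₁ F₂ : ℝ)
    (hρ₁ : -1 < ρ) (hρ₂ : ρ < 1) (hT : 0 < T)
    (hσ₁ : 0 < σ₁) (hσ₂ : 0 < σ₂) (hF₁ : 0 < F₁) (hF₂ : 0 < F₂)
    (φ₀ : ℝ) (hφ₀ : φ₀ ∈ Set.Ioo 0 Real.pi) (hcos : Real.cos φ₀ = ρ)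
    (ε₁ ε₂ : Ω → ℝ)
    (hε₁ : ε₁ = fun ω => Z₁ ω * Real.sin φ₀ - Z₂ ω * Real.cos φ₀)
    (hε₂ : ε₂ = fun ω => -Z₂ ω)
    (S₁ S₂ : Ω → ℝ)
    (hS₁ : S₁ = fun ω => F₁ * Real.exp (-(σ₁ ^ 2 * T) / 2 + σ₁ * Real.sqrt T * ε₁ ω))
    (hS₂ : S₂ = fun ω => F₂ * Real.exp (-(σ₂ ^ 2 * T) / 2 + σ₂ * Real.sqrt T * ε₂ ω))
    (a b : ℝ) (ha : 0 < a)
    (σbar : ℝ)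
    (hσbar : σbar = Real.sqrt (σ₁ ^ 2 + σ₂ ^ 2 * b ^ 2 - 2 * σ₁ * σ₂ * b * Real.cos φ₀))
    (θ₀ : ℝ)
    (hsinθ₀ : Real.sin θ₀ = -(σ₁ * Real.sin φ₀) / σbar)
    (hcosθ₀ : Real.cos θ₀ = (σ₂ * b - σ₁ * Real.cos φ₀) / σbar)
    (d₀ : ℝ)
    (hd₀ : d₀ = (Real.log (F₁ / a) - σ₁ ^ 2 * T / 2 + b * σ₂ ^ 2 * T / 2)
      / (σbar * Real.sqrt T)) :
    {ω | Z₁ ω * Real.sin θ₀ - Z₂ ω * Real.cos θ₀ ≤ d₀}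
      = {ω | a * S₂ ω ^ b / F₂ ^ b ≤ S₁ ω} := by
  subst hε₁ hε₂ hS₁ hS₂
  have hpos : 0 < σbar := by
    have hsin : 0 < sin φ₀ := sin_pos_of_pos_of_lt_pi hφ₀.1 hφ₀.2
    have hsum_sq : σ₁ ^ 2 + σ₂ ^ 2 * b ^ 2 - 2 * σ₁ * σ₂ * b * cos φ₀
        = (σ₁ * sin φ₀) ^ 2 + (σ₂ * b - σ₁ * cos φ₀) ^ 2 := by
      linear_combination -σ₁ ^ 2 * sin_sq_add_cos_sq φ₀
    rw [hσbar, hsum_sq]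
    positivity
  have hsqrtT : 0 < √T := sqrt_pos.mpr hT
  ext ω
  simp only [Set.mem_ofPred_eq]
  have hY : (Z₁ ω * sin θ₀ - Z₂ ω * cos θ₀) * (σbar * √T)
      = √T * (Z₁ ω * -(σ₁ * sin φ₀) - Z₂ ω * (σ₂ * b - σ₁ * cos φ₀)) := by
    rw [hsinθ₀, hcosθ₀]
    field_simp
  rw [hd₀, le_div_iff₀ (by positivity), hY, mul_rpow hF₂.le (exp_pos _).le, ← exp_mul,
    mul_div_assoc a, mul_div_cancel_left₀ _ (rpow_pos_of_pos hF₂ b).ne',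
    ← log_le_log_iff (mul_pos ha (exp_pos _)) (mul_pos hF₁ (exp_pos _)), log_mul ha.ne' (exp_ne_zero _),
    log_mul hF₁.ne' (exp_ne_zero _), log_exp, log_exp, log_div hF₁.ne' ha.ne']
  constructor <;> intro h <;> linarith
end

section
/- (Proposition 3.2, corollary: Bjerksund–Stensland bound is dominated by the Carmona–Durrleman bound) For K ∈ ℝ define Π_T^{CD} = sup over θ ∈ ℝ and d ∈ ℝ of e^{-rT}·E[ (S₁(T) - S₂(T) - K) · 1_{Z₁·sin θ - Z₂·cos θ ≤ d} ], and Π_T^{BS} = sup over a > 0 and b ∈ ℝ of e^{-rT}·E[ (S₁(T) - S₂(T) - K) · 1_{S₁(T) ≥ a·S₂(T)^b / F₂^b} ]. Then Π_T^{BS} ≤ Π_T^{CD}. -/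
open MeasureTheory ProbabilityTheory Real

/-- A closed half-plane with normal vector `(A, B) ≠ 0` can be described by a unit normal. -/
theorem exists_angle_halfPlane {A B : ℝ} (hA : A ≠ 0) (c : ℝ) :
    ∃ θ d : ℝ, ∀ x y : ℝ, c ≤ A * x + B * y ↔ x * sin θ - y * cos θ ≤ d := by
  set z : ℂ := ⟨B, -A⟩
  have hz : z ≠ 0 := fun h => hA (by simpa [z] using congrArg Complex.im h)
  have hR : 0 < ‖z‖ := norm_pos_iff.mpr hz
  have hc : ‖z‖ * cos z.arg = B := Complex.norm_mul_cos_arg z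
  have hs : ‖z‖ * sin z.arg = -A := Complex.norm_mul_sin_arg z
  refine ⟨z.arg, -c / ‖z‖, fun x y => ?_⟩
  rw [le_div_iff₀ hR]
  have h : (x * sin z.arg - y * cos z.arg) * ‖z‖ = -(A * x + B * y) := by
    linear_combination x * hs - y * hc
  rw [h, neg_le_neg_iff]

theorem integrable_exp_mul_of_map_eq_gaussianReal {Ω : Type*} [MeasurableSpace Ω] {P : Measure Ω}
    {Z : Ω → ℝ} (hm : Measurable Z) (hZ : Measure.map Z P = gaussianReal 0 1) (t : ℝ) :
    Integrable (fun ω => exp (t * Z ω)) P := by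
  have h := integrable_exp_mul_gaussianReal (μ := 0) (v := 1) t
  rw [← hZ] at h
  exact h.comp_measurable hm

/-- (Proposition 3.2, corollary: the Bjerksund–Stensland lower bound is dominated by the
Carmona–Durrleman lower bound) With
`Π_T^{CD} = sup_{θ,d} e^{-rT}·E[(S₁(T) - S₂(T) - K)·1_{Z₁ sin θ - Z₂ cos θ ≤ d}]` and
`Π_T^{BS} = sup_{a>0, b} e^{-rT}·E[(S₁(T) - S₂(T) - K)·1_{S₁(T) ≥ a·S₂(T)^b/F₂^b}]`,
one has `Π_T^{BS} ≤ Π_T^{CD}`. -/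
theorem bjerksund_stensland_le_carmona_durrleman
    {Ω : Type*} [MeasurableSpace Ω] (P : Measure Ω) [IsProbabilityMeasure P]
    (Z₁ Z₂ : Ω → ℝ) (hmZ₁ : Measurable Z₁) (hmZ₂ : Measurable Z₂)
    (hZ₁ : Measure.map Z₁ P = gaussianReal 0 1)
    (hZ₂ : Measure.map Z₂ P = gaussianReal 0 1)
    (hindep : IndepFun Z₁ Z₂ P)
    (ρ r T σ₁ σ₂ F₁ F₂ K : ℝ)
    (hρ₁ : -1 < ρ) (hρ₂ : ρ < 1) (hT : 0 < T)
    (hσ₁ : 0 < σ₁) (hσ₂ : 0 < σ₂) (hF₁ : 0 < F₁) (hF₂ : 0 < F₂)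
    (φ₀ : ℝ) (hφ₀ : φ₀ ∈ Set.Ioo 0 Real.pi) (hcos : Real.cos φ₀ = ρ)
    (ε₁ ε₂ : Ω → ℝ)
    (hε₁ : ε₁ = fun ω => Z₁ ω * Real.sin φ₀ - Z₂ ω * Real.cos φ₀)
    (hε₂ : ε₂ = fun ω => -Z₂ ω)
    (S₁ S₂ : Ω → ℝ)
    (hS₁ : S₁ = fun ω => F₁ * Real.exp (-(σ₁ ^ 2 * T) / 2 + σ₁ * Real.sqrt T * ε₁ ω))
    (hS₂ : S₂ = fun ω => F₂ * Real.exp (-(σ₂ ^ 2 * T) / 2 + σ₂ * Real.sqrt T * ε₂ ω)) :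
    sSup {x : ℝ | ∃ a : ℝ, 0 < a ∧ ∃ b : ℝ,
        x = Real.exp (-(r * T)) *
          ∫ ω in {ω | a * S₂ ω ^ b / F₂ ^ b ≤ S₁ ω}, (S₁ ω - S₂ ω - K) ∂P}
      ≤ sSup {x : ℝ | ∃ θ d : ℝ,
        x = Real.exp (-(r * T)) *
          ∫ ω in {ω | Z₁ ω * Real.sin θ - Z₂ ω * Real.cos θ ≤ d}, (S₁ ω - S₂ ω - K) ∂P} := by
  have hsin : 0 < sin φ₀ := sin_pos_of_pos_of_lt_pi hφ₀.1 hφ₀.2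
  have hsT : 0 < √T := sqrt_pos.mpr hT
  have hint₁ : Integrable S₁ P := by
    have hi : IndepFun (fun ω => exp (σ₁ * √T * sin φ₀ * Z₁ ω))
        (fun ω => exp (-(σ₁ * √T * cos φ₀) * Z₂ ω)) P :=
      hindep.comp (φ := fun x => exp (σ₁ * √T * sin φ₀ * x))
        (ψ := fun x => exp (-(σ₁ * √T * cos φ₀) * x)) (by fun_prop) (by fun_prop)
    have h := (hi.integrable_mul
      (integrable_exp_mul_of_map_eq_gaussianReal hmZ₁ hZ₁ _)
      (integrable_exp_mul_of_map_eq_gaussianReal hmZ₂ hZ₂ _)).const_mul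
        (F₁ * exp (-(σ₁ ^ 2 * T) / 2))
    refine h.congr (.of_forall fun ω => ?_)
    simp only [hS₁, hε₁, Pi.mul_apply]
    rw [← exp_add, mul_assoc, ← exp_add]
    ring_nf
  have hint₂ : Integrable S₂ P := by
    refine ((integrable_exp_mul_of_map_eq_gaussianReal hmZ₂ hZ₂ (-(σ₂ * √T))).const_mul
      (F₂ * exp (-(σ₂ ^ 2 * T) / 2))).congr (.of_forall fun ω => ?_)
    simp only [hS₂, hε₂]
    rw [mul_assoc, ← exp_add]
    ring_nf
  have hint : Integrable (fun ω => S₁ ω - S₂ ω - K) P :=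
    (hint₁.sub hint₂).sub (integrable_const K)
  refine csSup_le_csSup ?_ ⟨_, 1, one_pos, 0, rfl⟩ ?_
  · refine ⟨exp (-(r * T)) * ∫ ω, |S₁ ω - S₂ ω - K| ∂P, ?_⟩
    rintro x ⟨θ, d, rfl⟩
    gcongr
    calc _ ≤ ∫ ω in {ω | Z₁ ω * sin θ - Z₂ ω * cos θ ≤ d}, |S₁ ω - S₂ ω - K| ∂P :=
          integral_mono hint.integrableOn hint.abs.integrableOn fun ω => le_abs_self _
      _ ≤ _ := setIntegral_le_integral hint.abs (.of_forall fun ω => abs_nonneg _)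
  · rintro x ⟨a, ha, b, rfl⟩
    obtain ⟨θ, d, h⟩ := exists_angle_halfPlane (A := σ₁ * √T * sin φ₀)
      (B := b * σ₂ * √T - σ₁ * √T * cos φ₀) (by positivity)
      (log a - log F₁ + σ₁ ^ 2 * T / 2 - b * (σ₂ ^ 2 * T / 2))
    refine ⟨θ, d, ?_⟩
    suffices hset : {ω | a * S₂ ω ^ b / F₂ ^ b ≤ S₁ ω} =
        {ω | Z₁ ω * sin θ - Z₂ ω * cos θ ≤ d} by rw [hset]
    ext ω
    rw [Set.mem_ofPred_eq, Set.mem_ofPred_eq, ← h]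
    have hF : F₂ ^ b ≠ 0 := (rpow_pos_of_pos hF₂ b).ne'
    have hl : a * S₂ ω ^ b / F₂ ^ b =
        exp (log a + (-(σ₂ ^ 2 * T) / 2 + σ₂ * √T * ε₂ ω) * b) := by
      rw [exp_add, exp_log ha, exp_mul]
      simp only [hS₂]
      rw [mul_rpow hF₂.le (exp_pos _).le]
      field_simp
    have hr : S₁ ω = exp (log F₁ + (-(σ₁ ^ 2 * T) / 2 + σ₁ * √T * ε₁ ω)) := by
      rw [exp_add, exp_log hF₁, hS₁]
    rw [hl, hr, exp_le_exp, hε₁, hε₂, ← sub_nonneg, ← sub_nonneg (b := log a - _ + _ - _)]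
    ring_nf
end
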